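/- Let $S\subset\mathbb{R}^d$ be a simplex with vertices $v_1,\dots,v_{d+1}$ and nonempty interior. For any real $t>0$, any $y\in\mathbb{R}^d$, and any $R>\max_j |\langle v_j,y\rangle|$, $\int_{tS}e^{-2\pi i\langle x,y\rangle}dx = \frac{(-1)^d d!}{(2\pi i)^{d+1}}\lambda(S)\int_{|z|=R}\frac{e^{-2\pi i z t}}{(z-\langle v_1,y\rangle)\cdots(z-\langle v_{d+1},y\rangle)}\,dz$. -/

import Mathlib

open Pointwise

/-- The corner simplex `{u ≥ 0, ∑ u ≤ t}`. -/
def cornerSx (d : ℕ) (t : ℝ) : Set (Fin d → ℝ) := {u | (∀ i, 0 ≤ u i) ∧ ∑ i, u i ≤ t}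

lemma cornerSx_isClosed (d : ℕ) (t : ℝ) : IsClosed (cornerSx d t) := by
  have h : cornerSx d t = (⋂ i, {u | 0 ≤ u i}) ∩ {u | ∑ i, u i ≤ t} := by
    ext u; simp [cornerSx]
  rw [h]
  refine IsClosed.inter (isClosed_iInter fun i => isClosed_le (by fun_prop) (by fun_prop))
    (isClosed_le (by fun_prop) (by fun_prop))

lemma cornerSx_isCompact (d : ℕ) (t : ℝ) : IsCompact (cornerSx d t) := by
  refine (isCompact_Icc (a := (fun _ => 0 : Fin d → ℝ)) (b := fun _ => t)).of_isClosed_subset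
    (cornerSx_isClosed d t) ?_
  rintro u ⟨h0, h1⟩
  refine ⟨fun i => h0 i, fun i => ?_⟩
  exact (Finset.single_le_sum (fun j _ => h0 j) (Finset.mem_univ i)).trans h1

lemma cornerSx_convex (d : ℕ) (t : ℝ) : Convex ℝ (cornerSx d t) := by
  rintro u ⟨hu0, hu1⟩ w ⟨hw0, hw1⟩ p q hp hq hpq
  refine ⟨fun i => ?_, ?_⟩
  · have := mul_nonneg hp (hu0 i)
    have := mul_nonneg hq (hw0 i)
    simp; linarith
  · simp only [Pi.add_apply, Pi.smul_apply, smul_eq_mul, Finset.sum_add_distrib, ← Finset.mul_sum]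
    have := mul_le_mul_of_nonneg_left hu1 hp
    have := mul_le_mul_of_nonneg_left hw1 hq
    have : p * t + q * t = t := by rw [← add_mul, hpq, one_mul]
    linarith

lemma cornerSx_cons (d : ℕ) (t s : ℝ) (u : Fin d → ℝ) :
    (Fin.cons s u : Fin (d + 1) → ℝ) ∈ cornerSx (d + 1) t ↔ 0 ≤ s ∧ s ≤ t ∧ u ∈ cornerSx d (t - s) := by
  simp only [cornerSx, Set.mem_ofPred_eq, Fin.forall_fin_succ, Fin.sum_univ_succ, Fin.cons_zero,
    Fin.cons_succ]
  constructor
  · rintro ⟨⟨h1, h2⟩, h3⟩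
    have : 0 ≤ ∑ i, u i := Finset.sum_nonneg fun i _ => h2 i
    exact ⟨h1, by linarith, h2, by linarith⟩
  · rintro ⟨h1, h2, h3, h4⟩
    exact ⟨⟨h1, h3⟩, by linarith⟩

open MeasureTheory in
lemma cornerSx_fubini (d : ℕ) (t : ℝ) (ht : 0 ≤ t) (f : (Fin (d + 1) → ℝ) → ℂ) (hf : Continuous f) :
    ∫ u in cornerSx (d + 1) t, f u
      = ∫ s in (0:ℝ)..t, ∫ u in cornerSx d (t - s), f (Fin.cons s u) := by
  have hm : MeasurableSet (cornerSx (d + 1) t) := (cornerSx_isClosed _ _).measurableSet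
  have hi : Integrable ((cornerSx (d + 1) t).indicator f) := by
    rw [integrable_indicator_iff hm]
    exact hf.continuousOn.integrableOn_compact (cornerSx_isCompact _ _)
  have mp := (volume_preserving_piFinSuccAbove (fun _ : Fin (d + 1) => ℝ) 0).symm
  rw [← integral_indicator hm]
  rw [← mp.integral_comp (MeasurableEquiv.measurableEmbedding _)]
  have hi' : Integrable (fun x => (cornerSx (d + 1) t).indicator f
      ((MeasurableEquiv.piFinSuccAbove (fun _ : Fin (d + 1) => ℝ) 0).symm x)) :=
    (mp.integrable_comp_emb (MeasurableEquiv.measurableEmbedding _)).2 hi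
  rw [Measure.volume_eq_prod, integral_prod _ hi', intervalIntegral.integral_of_le ht,
    ← integral_Icc_eq_integral_Ioc, ← integral_indicator measurableSet_Icc]
  congr 1
  ext s
  have key : ∀ u : Fin d → ℝ, (MeasurableEquiv.piFinSuccAbove (fun _ : Fin (d + 1) => ℝ) 0).symm (s, u)
      = Fin.cons s u := by
    intro u
    simp [MeasurableEquiv.piFinSuccAbove]
    rfl
  by_cases hs : s ∈ Set.Icc 0 t
  · rw [Set.indicator_of_mem hs, ← integral_indicator (cornerSx_isClosed _ _).measurableSet]
    congr 1
    ext u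
    rw [key]
    by_cases hu : u ∈ cornerSx d (t - s)
    · rw [Set.indicator_of_mem hu, Set.indicator_of_mem ((cornerSx_cons _ _ _ _).2 ⟨hs.1, hs.2, hu⟩)]
    · rw [Set.indicator_of_notMem hu,
        Set.indicator_of_notMem (fun h => hu ((cornerSx_cons _ _ _ _).1 h).2.2)]
  · rw [Set.indicator_of_notMem hs]
    rw [← integral_zero (Fin d → ℝ) ℂ]
    congr 1
    ext u
    rw [key, Set.indicator_of_notMem]
    intro h
    have := (cornerSx_cons _ _ _ _).1 h
    exact hs ⟨this.1, this.2.1⟩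

lemma contour_zero (m : ℕ) (w : Fin (m + 2) → ℂ) (R : ℝ) (hw : ∀ j, ‖w j‖ < R) :
    ∮ z in C(0, R), (∏ j, (z - w j))⁻¹ = 0 := by
  have hR : 0 < R := (norm_nonneg _).trans_lt (hw 0)
  have hne : ∀ z : ℂ, R ≤ ‖z‖ → ∏ j, (z - w j) ≠ 0 := by
    intro z hz
    rw [Finset.prod_ne_zero_iff]
    intro j _ h
    rw [sub_eq_zero] at h
    have := hw j
    rw [h] at hz
    linarith
  have heq : ∀ r, R ≤ r → ∮ z in C(0, r), (∏ j, (z - w j))⁻¹ = ∮ z in C(0, R), (∏ j, (z - w j))⁻¹ := by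
    intro r hr
    refine Complex.circleIntegral_eq_of_differentiable_on_annulus_off_countable hR hr
      Set.countable_empty ?_ ?_
    · refine ContinuousOn.inv₀ (by fun_prop) fun z hz => hne z ?_
      simpa using hz.2
    · intro z hz
      refine DifferentiableAt.inv (by fun_prop) (hne z ?_)
      have := hz.1.2
      simp at this
      exact this.le
  have hb : ∀ r, R + 1 ≤ r → ‖∮ z in C(0, R), (∏ j, (z - w j))⁻¹‖ ≤ 2 * Real.pi * r * ((r - R) ^ 2)⁻¹ := by
    intro r hr
    rw [← heq r (by linarith)]
    refine circleIntegral.norm_integral_le_of_norm_le_const (by linarith) ?_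
    intro z hz
    have hz : ‖z‖ = r := by simpa using hz
    rw [norm_inv, norm_prod]
    have hj : ∀ j, r - R ≤ ‖z - w j‖ := by
      intro j
      have := norm_sub_norm_le z (w j)
      have := hw j
      linarith
    have h1 : (1:ℝ) ≤ r - R := by linarith
    refine inv_anti₀ (by positivity) ?_
    calc (r - R) ^ 2 ≤ (r - R) ^ (m + 2) := pow_le_pow_right₀ h1 (by omega)
      _ = ∏ j : Fin (m + 2), (r - R) := by simp
      _ ≤ _ := Finset.prod_le_prod (fun _ _ => by linarith) (fun j _ => hj j)
  have hlim : Filter.Tendsto (fun k : ℝ => 2 * Real.pi * (k + R) * (k ^ 2)⁻¹) Filter.atTop (nhds 0) := by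
    have h1 : Filter.Tendsto (fun k : ℝ => k⁻¹) Filter.atTop (nhds 0) := tendsto_inv_atTop_zero
    have h2 := ((h1.add ((h1.mul h1).const_mul R)).const_mul (2 * Real.pi))
    simp only [mul_zero, add_zero] at h2
    refine h2.congr' ?_
    filter_upwards [Filter.eventually_gt_atTop 0] with k hk
    field_simp
  rw [← norm_le_zero_iff]
  refine ge_of_tendsto hlim ?_
  filter_upwards [Filter.eventually_ge_atTop 1] with k hk
  have := hb (k + R) (by linarith)
  simpa using this

lemma corner_formula (c b : ℂ) (hc : c ≠ 0) (R : ℝ) (hb : ‖b‖ < R) (d : ℕ) :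
    ∀ (a : Fin d → ℂ) (_ : ∀ i, ‖a i‖ < R) (t : ℝ) (_ : 0 ≤ t),
    ∫ u in cornerSx d t, Complex.exp (c * (t * b + ∑ i, (u i : ℂ) * (a i - b)))
      = (2 * Real.pi * Complex.I)⁻¹ * (c⁻¹) ^ d *
        ∮ z in C(0, R), Complex.exp (c * z * t) * ((z - b) * ∏ i, (z - a i))⁻¹ := by
  have hR : 0 < R := (norm_nonneg _).trans_lt hb
  have hpi : (2 * Real.pi * Complex.I : ℂ) ≠ 0 := by simp [Real.pi_ne_zero]
  induction d with
  | zero =>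
    intro a _ t ht
    have h1 : cornerSx 0 t = Set.univ := by ext u; simp [cornerSx, ht]
    have h2 := DifferentiableOn.circleIntegral_sub_inv_smul (R := R) (c := 0) (w := b)
      (f := fun z => Complex.exp (c * z * t)) (by fun_prop) (by simpa using hb)
    simp only [smul_eq_mul] at h2
    simp only [Finset.univ_eq_empty, Finset.prod_empty, mul_one, Finset.sum_empty, pow_zero, add_zero]
    rw [h1, MeasureTheory.setIntegral_univ]
    have h3 : ∮ z in C(0, R), Complex.exp (c * z * t) * (z - b)⁻¹
       = 2 * Real.pi * Complex.I * Complex.exp (c * b * t) := by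
      rw [← h2]; congr 1; ext z; ring
    rw [h3, inv_mul_cancel_left₀ hpi]
    simp [MeasureTheory.volume_pi, MeasureTheory.measureReal_def, MeasureTheory.Measure.pi_of_empty]
    ring_nf
  | succ d ih =>
    intro a ha t ht
    have hcont : ∀ (f : ℂ → ℂ), Continuous f → ∀ {n : ℕ} (p : Fin n → ℂ) (_ : ∀ i, ‖p i‖ < R),
        CircleIntegrable (fun z => f z * ((z - b) * ∏ i, (z - p i))⁻¹) 0 R := by
      intro f hf n p hp
      refine ContinuousOn.circleIntegrable hR.le ?_
      refine hf.continuousOn.mul (ContinuousOn.inv₀ (by fun_prop) ?_)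
      intro z hz
      have hz : ‖z‖ = R := by simpa using hz
      refine mul_ne_zero ?_ (Finset.prod_ne_zero_iff.2 fun i _ => ?_)
      · intro h; rw [sub_eq_zero] at h; rw [h] at hz; linarith
      · intro h; rw [sub_eq_zero] at h; rw [h] at hz; have := hp i; linarith
    rw [cornerSx_fubini d t ht _ (by fun_prop)]
    have hstep : ∀ s ∈ Set.uIcc 0 t, ∫ u in cornerSx d (t - s), Complex.exp (c * (t * b +
        ∑ i, (((Fin.cons s u : Fin (d + 1) → ℝ) i : ℝ) : ℂ) * (a i - b)))
        = (2 * Real.pi * Complex.I)⁻¹ * (c⁻¹) ^ d * ∮ z in C(0, R), Complex.exp (c * s * a 0) *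
          (Complex.exp (c * z * (t - s)) * ((z - b) * ∏ i : Fin d, (z - a i.succ))⁻¹) := by
      intro s hs
      rw [Set.uIcc_of_le ht] at hs
      have := ih (fun i => a i.succ) (fun i => ha _) (t - s) (by linarith [hs.2])
      rw [circleIntegral.integral_const_mul, mul_left_comm]
      push_cast at this
      rw [← this, ← MeasureTheory.integral_const_mul]
      congr 1
      ext u
      rw [← Complex.exp_add, Fin.sum_univ_succ]
      simp only [Fin.cons_zero, Fin.cons_succ]
      ring_nf
    rw [intervalIntegral.integral_congr hstep, intervalIntegral.integral_const_mul, pow_succ,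
      ← mul_assoc, mul_assoc _ c⁻¹]
    congr 1
    -- swap
    have hswap : ∫ s in (0:ℝ)..t, ∮ z in C(0, R), Complex.exp (c * s * a 0) *
          (Complex.exp (c * z * (t - s)) * ((z - b) * ∏ i : Fin d, (z - a i.succ))⁻¹)
        = ∮ z in C(0, R), ∫ s in (0:ℝ)..t, Complex.exp (c * s * a 0) *
          (Complex.exp (c * z * (t - s)) * ((z - b) * ∏ i : Fin d, (z - a i.succ))⁻¹) := by
      simp only [circleIntegral, ← intervalIntegral.integral_smul]
      rw [MeasureTheory.intervalIntegral_intervalIntegral_swap]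
      have hC : Continuous (Function.uncurry fun (x y : ℝ) => deriv (circleMap 0 R) y •
          (Complex.exp (c * x * a 0) * (Complex.exp (c * circleMap 0 R y * (t - x)) *
            ((circleMap 0 R y - b) * ∏ i : Fin d, (circleMap 0 R y - a i.succ))⁻¹))) := by
        simp only [Function.uncurry_def, deriv_circleMap]
        have hcm : Continuous fun p : ℝ × ℝ => circleMap 0 R p.2 :=
          (continuous_circleMap 0 R).comp continuous_snd
        refine Continuous.fun_smul ?_ (Continuous.fun_mul ?_ (Continuous.fun_mul ?_ ?_))
        · fun_prop
        · fun_prop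
        · fun_prop
        refine Continuous.inv₀ (by fun_prop) ?_
        intro p
        have hz : ‖circleMap 0 R p.2‖ = R := by simp [hR.le]
        refine mul_ne_zero ?_ (Finset.prod_ne_zero_iff.2 fun i _ => ?_)
        · intro h; rw [sub_eq_zero] at h; rw [h] at hz; linarith
        · intro h; rw [sub_eq_zero] at h; rw [h] at hz; have := ha i.succ; linarith
      refine (hC.continuousOn.integrableOn_compact
        ((isCompact_uIcc (a := (0:ℝ)) (b := t)).prod (isCompact_uIcc (a := (0:ℝ)) (b := 2 * Real.pi)))).mono_set ?_
      exact Set.prod_mono Set.uIoc_subset_uIcc Set.uIoc_subset_uIcc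
    rw [hswap]
    have hz0 : ∮ z in C(0, R), Complex.exp (c * a 0 * t) * ((z - b) * ∏ i, (z - a i))⁻¹ = 0 := by
      rw [circleIntegral.integral_const_mul]
      have := contour_zero d (Fin.cons b a : Fin (d + 2) → ℂ) R
        (by intro j; refine Fin.cases ?_ (fun i => ?_) j <;> simp [hb, ha])
      simp only [Fin.prod_univ_succ (n := d + 1), Fin.cons_zero, Fin.cons_succ] at this
      rw [this, mul_zero]
    have hsub := circleIntegral.integral_sub
      (hcont (fun z => Complex.exp (c * z * t)) (by fun_prop) a ha)
      (hcont (fun z => Complex.exp (c * a 0 * t)) (by fun_prop) a ha)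
    rw [hz0, sub_zero] at hsub
    rw [← hsub, ← circleIntegral.integral_const_mul]
    refine circleIntegral.integral_congr hR.le ?_
    intro z hz
    have hz : ‖z‖ = R := by simpa using hz
    have hza : z - a 0 ≠ 0 := by
      intro h; rw [sub_eq_zero] at h; rw [h] at hz; have := ha 0; linarith
    have hk : c * (a 0 - z) ≠ 0 := mul_ne_zero hc (by rw [← neg_sub]; exact neg_ne_zero.2 hza)
    have hint : ∫ s in (0:ℝ)..t, Complex.exp (c * (a 0 - z) * s)
        = (Complex.exp (c * (a 0 - z) * t) - 1) / (c * (a 0 - z)) := by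
      rw [integral_exp_mul_complex hk]; simp
    have : ∀ s : ℝ, Complex.exp (c * s * a 0) *
          (Complex.exp (c * z * (t - s)) * ((z - b) * ∏ i : Fin d, (z - a i.succ))⁻¹)
        = (Complex.exp (c * z * t) * ((z - b) * ∏ i : Fin d, (z - a i.succ))⁻¹) *
          Complex.exp (c * (a 0 - z) * s) := by
      intro s
      rw [mul_right_comm (Complex.exp (c * z * t)), ← Complex.exp_add, ← mul_assoc, ← Complex.exp_add]
      congr 2; ring
    simp only [this]
    rw [intervalIntegral.integral_const_mul, hint, Fin.prod_univ_succ]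
    have he : Complex.exp (c * a 0 * t) = Complex.exp (c * z * t) * Complex.exp (c * (a 0 - z) * t) := by
      rw [← Complex.exp_add]; congr 1; ring
    rw [he]
    generalize Complex.exp (c * z * t) = E
    generalize Complex.exp (c * (a 0 - z) * t) = F
    generalize ∏ i : Fin d, (z - a i.succ) = P
    have h5 : c * (a 0 - z) = -(c * (z - a 0)) := by ring
    rw [h5, div_eq_mul_inv]
    simp only [mul_inv, inv_neg]
    ring


lemma corner_volume (d : ℕ) : ∀ (t : ℝ) (_ : 0 ≤ t),
    ∫ _u in cornerSx d t, (1 : ℂ) = (t : ℂ) ^ d / d.factorial := by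
  induction d with
  | zero =>
    intro t ht
    have h1 : cornerSx 0 t = Set.univ := by ext u; simp [cornerSx, ht]
    rw [h1, MeasureTheory.setIntegral_univ]
    simp [MeasureTheory.volume_pi, MeasureTheory.measureReal_def, MeasureTheory.Measure.pi_of_empty]
  | succ d ih =>
    intro t ht
    rw [cornerSx_fubini d t ht _ continuous_const]
    have h : ∀ s ∈ Set.uIcc 0 t, ∫ _u in cornerSx d (t - s), (1 : ℂ)
        = (((t - s) ^ d / d.factorial : ℝ) : ℂ) := by
      intro s hs
      rw [Set.uIcc_of_le ht] at hs
      rw [ih _ (by linarith [hs.2])]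
      push_cast; rfl
    rw [intervalIntegral.integral_congr h, intervalIntegral.integral_ofReal,
      intervalIntegral.integral_div, intervalIntegral.integral_comp_sub_left (fun x => x ^ d)]
    simp only [sub_self, sub_zero, integral_pow, Nat.factorial_succ]
    push_cast
    simp
    field_simp

lemma hull_eq (d : ℕ) (v : Fin (d + 1) → (Fin d → ℝ)) (t : ℝ) (ht : 0 < t) :
    t • (convexHull ℝ (Set.range v)) =
      (fun u => t • v 0 + Fintype.linearCombination ℝ (fun i : Fin d => v i.succ - v 0) u) ''
        cornerSx d t := by
  set L := Fintype.linearCombination ℝ (fun i : Fin d => v i.succ - v 0) with hL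
  have h1 : convexHull ℝ (Set.range v) = (fun u => v 0 + L u) '' cornerSx d 1 := by
    apply Set.Subset.antisymm
    · apply convexHull_min
      · rintro _ ⟨j, rfl⟩
        refine Fin.cases ?_ (fun i => ?_) j
        · exact ⟨0, ⟨by simp, by simp⟩, by simp⟩
        · refine ⟨Pi.single i 1, ⟨fun k => ?_, by simp⟩, ?_⟩
          · by_cases hk : k = i
            · subst hk; simp
            · simp [hk]
          · simp [hL]
      · have := ((cornerSx_convex d 1).linear_image L).translate (v 0)
        rwa [Set.image_image] at this
    · rintro _ ⟨u, ⟨hu0, hu1⟩, rfl⟩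
      refine mem_convexHull_of_exists_fintype (Fin.cons (1 - ∑ i, u i) u : Fin (d + 1) → ℝ) v ?_ ?_ ?_ ?_
      · intro j
        refine Fin.cases ?_ (fun i => ?_) j
        · simpa using hu1
        · simpa using hu0 i
      · simp [Fin.sum_univ_succ]
      · intro j; exact ⟨j, rfl⟩
      · simp only [Fin.sum_univ_succ, Fin.cons_zero, Fin.cons_succ, hL,
          Fintype.linearCombination_apply, smul_sub, Finset.sum_sub_distrib, sub_smul, one_smul,
          Finset.sum_smul]
        abel
  rw [h1]
  ext x
  simp only [Set.mem_smul_set, Set.mem_image]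
  constructor
  · rintro ⟨_, ⟨u, ⟨hu0, hu1⟩, rfl⟩, rfl⟩
    refine ⟨t • u, ⟨fun i => mul_nonneg ht.le (hu0 i), ?_⟩, by simp⟩
    simp only [Pi.smul_apply, smul_eq_mul, ← Finset.mul_sum]
    nlinarith
  · rintro ⟨u, ⟨hu0, hu1⟩, rfl⟩
    refine ⟨_, ⟨t⁻¹ • u, ⟨fun i => mul_nonneg (inv_nonneg.2 ht.le) (hu0 i), ?_⟩, rfl⟩, ?_⟩
    · simp only [Pi.smul_apply, smul_eq_mul, ← Finset.mul_sum]
      rw [inv_mul_le_iff₀ ht]; linarith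
    · simp [ht.ne', smul_smul]

open MeasureTheory in
lemma hull_integral (d : ℕ) (v : Fin (d + 1) → (Fin d → ℝ))
    (hS : (interior (convexHull ℝ (Set.range v))).Nonempty) (t : ℝ) (ht : 0 < t)
    (g : (Fin d → ℝ) → ℂ) :
    ∫ x in t • (convexHull ℝ (Set.range v)), g x =
      ((|LinearMap.det (Fintype.linearCombination ℝ (fun i : Fin d => v i.succ - v 0))| : ℝ) : ℂ) *
      ∫ u in cornerSx d t,
        g (t • v 0 + Fintype.linearCombination ℝ (fun i : Fin d => v i.succ - v 0) u) := by
  rw [hull_eq d v t ht]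
  have h1 := hull_eq d v 1 one_pos
  set L := Fintype.linearCombination ℝ (fun i : Fin d => v i.succ - v 0) with hL
  have hdet : LinearMap.det L ≠ 0 := by
    intro h0
    rw [one_smul, one_smul] at h1
    have hpos : 0 < volume (convexHull ℝ (Set.range v)) :=
      (isOpen_interior.measure_pos volume hS).trans_le (measure_mono interior_subset)
    have h2 : (fun u => v 0 + L u) '' cornerSx d 1 = (fun x => v 0 + x) '' (L '' cornerSx d 1) := by
      rw [Set.image_image]
    rw [h1, h2, Set.image_add_left, measure_preimage_add, Measure.addHaar_image_linearMap, h0] at hpos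
    simp at hpos
  have hinj : Function.Injective L :=
    (LinearMap.equivOfDetNeZero L hdet).injective
  rw [integral_image_eq_integral_abs_det_fderiv_smul (f' := fun _ => LinearMap.toContinuousLinearMap L)
    volume (cornerSx_isClosed d t).measurableSet]
  · simp only [Complex.real_smul]
    rw [integral_const_mul]
    simp [ContinuousLinearMap.det]
  · intro x _
    exact (((LinearMap.toContinuousLinearMap L).hasFDerivAt).const_add _).hasFDerivWithinAt
  · intro x _ y _ hxy
    exact hinj (by simpa using hxy)

/-- contour integral representation of the Fourier transform of a simplex. -/
theorem stmt6 (d : ℕ) (v : Fin (d + 1) → (Fin d → ℝ))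
    (hS : (interior (convexHull ℝ (Set.range v))).Nonempty)
    (t : ℝ) (ht : 0 < t) (y : Fin d → ℝ) (R : ℝ)
    (hR : ∀ j, |∑ i, v j i * y i| < R) :
    ∫ x in t • (convexHull ℝ (Set.range v)),
        Complex.exp (-2 * Real.pi * Complex.I * ((∑ i, x i * y i : ℝ) : ℂ))
      = ((-1) ^ d * (d.factorial : ℂ) / (2 * Real.pi * Complex.I) ^ (d + 1)) *
        (((MeasureTheory.volume (convexHull ℝ (Set.range v))).toReal : ℝ) : ℂ) *
        ∮ z in C(0, R), Complex.exp (-2 * Real.pi * Complex.I * z * (t : ℂ)) /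
          ∏ j, (z - ((∑ i, v j i * y i : ℝ) : ℂ)) := by
  have hpi : (2 * Real.pi * Complex.I : ℂ) ≠ 0 := by simp [Real.pi_ne_zero]
  have hvol : (((MeasureTheory.volume (convexHull ℝ (Set.range v))).toReal : ℝ) : ℂ) =
      ((|LinearMap.det (Fintype.linearCombination ℝ (fun i : Fin d => v i.succ - v 0))| : ℝ) : ℂ)
        / d.factorial := by
    have h := hull_integral d v hS 1 one_pos (fun _ => 1)
    rw [corner_volume d 1 zero_le_one, one_smul] at h
    simpa [MeasureTheory.measureReal_def, div_eq_mul_inv] using h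
  rw [hvol, hull_integral d v hS t ht]
  have hdf : (d.factorial : ℂ) ≠ 0 := by exact_mod_cast d.factorial_ne_zero
  generalize ((|LinearMap.det (Fintype.linearCombination ℝ (fun i : Fin d => v i.succ - v 0))| : ℝ) : ℂ) = D
  have hn : ∀ j, ‖((∑ i, v j i * y i : ℝ) : ℂ)‖ < R := by
    intro j; rw [Complex.norm_real]; exact hR j
  have key := corner_formula (-2 * Real.pi * Complex.I) ((∑ i, v 0 i * y i : ℝ) : ℂ)
    (by simp [Real.pi_ne_zero]) R (hn 0) d (fun j => ((∑ i, v j.succ i * y i : ℝ) : ℂ))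
    (fun j => hn _) t ht.le
  have hlin : ∀ u : Fin d → ℝ, ((∑ i, (t • v 0 + Fintype.linearCombination ℝ
      (fun i : Fin d => v i.succ - v 0) u) i * y i : ℝ) : ℂ) =
      (t * ((∑ i, v 0 i * y i : ℝ) : ℂ) + ∑ j, (u j : ℂ) *
        (((∑ i, v j.succ i * y i : ℝ) : ℂ) - ((∑ i, v 0 i * y i : ℝ) : ℂ))) := by
    intro u
    norm_cast
    simp only [Pi.add_apply, Pi.smul_apply, smul_eq_mul, Fintype.linearCombination_apply,
      Finset.sum_apply, Pi.sub_apply, add_mul, Finset.sum_add_distrib, Finset.mul_sum,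
      Finset.sum_mul, ← Finset.sum_sub_distrib]
    congr 1
    · exact Finset.sum_congr rfl fun i _ => by ring
    · rw [Finset.sum_comm]
      exact Finset.sum_congr rfl fun i _ => Finset.sum_congr rfl fun j _ => by ring
  simp only [hlin]
  rw [key]
  simp only [Fin.prod_univ_succ (n := d), div_eq_mul_inv (Complex.exp _)]
  generalize (∮ z in C(0, R), _ : ℂ) = J
  have h3 : (-2 * Real.pi * Complex.I : ℂ) = (-1) * (2 * Real.pi * Complex.I) := by ring
  rw [h3]
  generalize (2 * Real.pi * Complex.I : ℂ) = P at *
  have h4 : ((-1 : ℂ) * P)⁻¹ ^ d = (-1) ^ d * (P ^ d)⁻¹ := by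
    rw [mul_inv, mul_pow, inv_pow P]; norm_num
  rw [h4, pow_succ]
  field_simp
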